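/- There exist four unit equilateral triangles in the plane such that the 1-dimensional Hausdorff measure of the topological frontier of their union is strictly greater than 4√3 times the 2-dimensional Lebesgue measure of their union; that is, the perimeter-to-area ratio of the union exceeds 4√3, the ratio of a single unit equilateral triangle. -/

import Mathlib

open MeasureTheory Real Set

noncomputable section

/-- A unit equilateral triangle: the convex hull of three points at pairwise distance 1. -/
def IsUnitEquilateralTriangle (S : Set (EuclideanSpace ℝ (Fin 2))) : Prop :=
  ∃ a b c : EuclideanSpace ℝ (Fin 2),
    dist a b = 1 ∧ dist a c = 1 ∧ dist b c = 1 ∧ S = convexHull ℝ {a, b, c}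

/-- Half of a set invariant under a measure-preserving map, lower bound. -/
theorem two_mul_measure_inter_le {α : Type*} [MeasurableSpace α] {μ : Measure α} {σ : α ≃ᵐ α}
    (hσ : MeasurePreserving σ μ μ) {A D : Set α} (hA : σ ⁻¹' A = A) (hD : MeasurableSet D)
    (hdisj : Disjoint D (σ ⁻¹' D)) : 2 * μ (A ∩ D) ≤ μ A := by
  have h1 : μ (A ∩ σ ⁻¹' D) = μ (A ∩ D) := by
    rw [← hσ.measure_preimage_equiv (A ∩ D), preimage_inter, hA]
  calc 2 * μ (A ∩ D) = μ (A ∩ D) + μ (A ∩ σ ⁻¹' D) := by rw [h1, two_mul]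
    _ ≤ μ (A ∩ D) + μ (A \ D) := by
        gcongr
        exact fun x hx => ⟨hx.1, fun hxD => hdisj.le_bot ⟨hxD, hx.2⟩⟩
    _ = μ A := measure_inter_add_sdiff A hD

/-- Half of a set invariant under a measure-preserving map, upper bound. -/
theorem measure_le_two_mul_inter {α : Type*} [MeasurableSpace α] {μ : Measure α} {σ : α ≃ᵐ α}
    (hσ : MeasurePreserving σ μ μ) {A D : Set α} (hA : σ ⁻¹' A = A)
    (hcover : ∀ x, x ∈ D ∨ σ x ∈ D) : μ A ≤ 2 * μ (A ∩ D) := by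
  have h1 : μ (A ∩ σ ⁻¹' D) = μ (A ∩ D) := by
    rw [← hσ.measure_preimage_equiv (A ∩ D), preimage_inter, hA]
  calc μ A ≤ μ ((A ∩ D) ∪ (A ∩ σ ⁻¹' D)) :=
        measure_mono fun x hx => (hcover x).imp (fun h => ⟨hx, h⟩) (fun h => ⟨hx, h⟩)
    _ ≤ μ (A ∩ D) + μ (A ∩ σ ⁻¹' D) := measure_union_le _ _
    _ = 2 * μ (A ∩ D) := by rw [h1, two_mul]

/-- Reflection of the plane in the second coordinate axis. -/
def flipFst : EuclideanSpace ℝ (Fin 2) ≃ₗᵢ[ℝ] EuclideanSpace ℝ (Fin 2) where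
  toLinearEquiv := LinearEquiv.ofInvolutive
    { toFun := fun p => !₂[-p 0, p 1]
      map_add' := fun p q => by ext i; fin_cases i <;> simp [add_comm]
      map_smul' := fun r p => by ext i; fin_cases i <;> simp }
    (fun p => by ext i; fin_cases i <;> simp)
  norm_map' := fun p => by
    simp [LinearEquiv.ofInvolutive, EuclideanSpace.norm_eq, Fin.sum_univ_two]

/-- Reflection of the plane in the first coordinate axis. -/
def flipSnd : EuclideanSpace ℝ (Fin 2) ≃ₗᵢ[ℝ] EuclideanSpace ℝ (Fin 2) where
  toLinearEquiv := LinearEquiv.ofInvolutive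
    { toFun := fun p => !₂[p 0, -p 1]
      map_add' := fun p q => by ext i; fin_cases i <;> simp [add_comm]
      map_smul' := fun r p => by ext i; fin_cases i <;> simp }
    (fun p => by ext i; fin_cases i <;> simp)
  norm_map' := fun p => by
    simp [LinearEquiv.ofInvolutive, EuclideanSpace.norm_eq, Fin.sum_univ_two]

/-- Reflection of the plane in the diagonal. -/
def swapCoords : EuclideanSpace ℝ (Fin 2) ≃ₗᵢ[ℝ] EuclideanSpace ℝ (Fin 2) where
  toLinearEquiv := LinearEquiv.ofInvolutive
    { toFun := fun p => !₂[p 1, p 0]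
      map_add' := fun p q => by ext i; fin_cases i <;> simp
      map_smul' := fun r p => by ext i; fin_cases i <;> simp }
    (fun p => by ext i; fin_cases i <;> simp)
  norm_map' := fun p => by
    simp [LinearEquiv.ofInvolutive, EuclideanSpace.norm_eq, Fin.sum_univ_two, add_comm]

@[simp] theorem flipFst_apply (p : EuclideanSpace ℝ (Fin 2)) : flipFst p = !₂[-p 0, p 1] := rfl

@[simp] theorem flipSnd_apply (p : EuclideanSpace ℝ (Fin 2)) : flipSnd p = !₂[p 0, -p 1] := rfl

@[simp] theorem swapCoords_apply (p : EuclideanSpace ℝ (Fin 2)) : swapCoords p = !₂[p 1, p 0] := rfl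

theorem IsUnitEquilateralTriangle.preimage {S : Set (EuclideanSpace ℝ (Fin 2))}
    (hS : IsUnitEquilateralTriangle S)
    (σ : EuclideanSpace ℝ (Fin 2) ≃ₗᵢ[ℝ] EuclideanSpace ℝ (Fin 2)) :
    IsUnitEquilateralTriangle (σ ⁻¹' S) := by
  obtain ⟨a, b, c, hab, hac, hbc, rfl⟩ := hS
  refine ⟨σ.symm a, σ.symm b, σ.symm c, by simpa, by simpa, by simpa, ?_⟩
  have h := σ.symm.toLinearEquiv.toLinearMap.image_convexHull {a, b, c}
  have h2 : σ ⁻¹' convexHull ℝ {a, b, c} = σ.symm '' convexHull ℝ {a, b, c} :=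
    (σ.symm.toEquiv.image_eq_preimage_symm _).symm
  rw [h2]
  simpa [image_insert_eq] using h

/-- The unit triangle with horizontal upper side at height `44/125`, apex down, symmetric in the
second coordinate axis. -/
def downTriangle : Set (EuclideanSpace ℝ (Fin 2)) :=
  {p | p 1 ≤ 44 / 125 ∧ √3 * p 0 - p 1 ≤ √3 / 2 - 44 / 125 ∧
    -(√3 * p 0) - p 1 ≤ √3 / 2 - 44 / 125}

theorem isUnitEquilateralTriangle_downTriangle : IsUnitEquilateralTriangle downTriangle := by
  have h3 : √3 * √3 = 3 := Real.mul_self_sqrt (by norm_num)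
  have hpos : 0 < √3 := by positivity
  refine ⟨!₂[1 / 2, 44 / 125], !₂[-1 / 2, 44 / 125], !₂[0, 44 / 125 - √3 / 2], ?_, ?_, ?_, ?_⟩
  · rw [EuclideanSpace.dist_eq]
    norm_num [Fin.sum_univ_two, Real.dist_eq]
  · rw [EuclideanSpace.dist_eq, Real.sqrt_eq_one]
    norm_num [Fin.sum_univ_two, Real.dist_eq, sq_abs]
    nlinarith
  · rw [EuclideanSpace.dist_eq, Real.sqrt_eq_one]
    norm_num [Fin.sum_univ_two, Real.dist_eq, sq_abs]
    nlinarith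
  · apply Subset.antisymm
    · rintro p ⟨h1, h2, h4⟩
      set w : Fin 3 → ℝ := ![(1 - 2 / 3 * √3 * (44 / 125 - p 1)) / 2 + p 0,
        (1 - 2 / 3 * √3 * (44 / 125 - p 1)) / 2 - p 0, 2 / 3 * √3 * (44 / 125 - p 1)] with hw
      set z : Fin 3 → EuclideanSpace ℝ (Fin 2) := ![!₂[1 / 2, 44 / 125], !₂[-1 / 2, 44 / 125],
        !₂[0, 44 / 125 - √3 / 2]] with hz
      have hp : p = ∑ i, w i • z i := by
        ext i
        fin_cases i
        · simp [hw, hz, Fin.sum_univ_three]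
          ring
        · simp [hw, hz, Fin.sum_univ_three]
          linear_combination (1 / 3) * (44 / 125 - p 1) * h3
      rw [hp]
      refine (convex_convexHull ℝ _).sum_mem ?_ ?_ ?_
      · intro i _
        fin_cases i <;> simp [hw] <;> nlinarith
      · simp [hw, Fin.sum_univ_three]
      · intro i _
        apply subset_convexHull
        fin_cases i <;> simp [hz]
    · apply convexHull_min
      · rintro p (rfl | rfl | rfl) <;> refine ⟨?_, ?_, ?_⟩ <;> simp <;> linarith
      · have l0 : IsLinearMap ℝ fun p : EuclideanSpace ℝ (Fin 2) => p 1 :=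
          ⟨fun p q => by simp, fun r p => by simp⟩
        have l1 : IsLinearMap ℝ fun p : EuclideanSpace ℝ (Fin 2) => √3 * p 0 - p 1 :=
          ⟨fun p q => by simp; ring, fun r p => by simp; ring⟩
        have l2 : IsLinearMap ℝ fun p : EuclideanSpace ℝ (Fin 2) => -(√3 * p 0) - p 1 :=
          ⟨fun p q => by simp; ring, fun r p => by simp; ring⟩
        exact (convex_halfSpace_le l0 _).inter
          ((convex_halfSpace_le l1 _).inter (convex_halfSpace_le l2 _))

/-- The four rotations of `downTriangle` by multiples of a right angle. -/
def rotatedTriangle : Fin 4 → Set (EuclideanSpace ℝ (Fin 2)) :=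
  ![downTriangle, flipSnd ⁻¹' downTriangle, swapCoords ⁻¹' downTriangle,
    swapCoords ⁻¹' (flipSnd ⁻¹' downTriangle)]

theorem mem_iUnion_rotatedTriangle (p : EuclideanSpace ℝ (Fin 2)) :
    p ∈ ⋃ i, rotatedTriangle i ↔
      (p 1 ≤ 44 / 125 ∧ √3 * p 0 - p 1 ≤ √3 / 2 - 44 / 125 ∧
        -(√3 * p 0) - p 1 ≤ √3 / 2 - 44 / 125) ∨
      (-p 1 ≤ 44 / 125 ∧ √3 * p 0 + p 1 ≤ √3 / 2 - 44 / 125 ∧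
        -(√3 * p 0) + p 1 ≤ √3 / 2 - 44 / 125) ∨
      (p 0 ≤ 44 / 125 ∧ √3 * p 1 - p 0 ≤ √3 / 2 - 44 / 125 ∧
        -(√3 * p 1) - p 0 ≤ √3 / 2 - 44 / 125) ∨
      (-p 0 ≤ 44 / 125 ∧ √3 * p 1 + p 0 ≤ √3 / 2 - 44 / 125 ∧
        -(√3 * p 1) + p 0 ≤ √3 / 2 - 44 / 125) := by
  simp [Fin.exists_fin_succ, rotatedTriangle, downTriangle]

theorem flipFst_preimage_iUnion :
    flipFst ⁻¹' (⋃ i, rotatedTriangle i) = ⋃ i, rotatedTriangle i := by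
  ext p
  rw [mem_preimage, mem_iUnion_rotatedTriangle, mem_iUnion_rotatedTriangle]
  simp
  grind

theorem flipSnd_preimage_iUnion :
    flipSnd ⁻¹' (⋃ i, rotatedTriangle i) = ⋃ i, rotatedTriangle i := by
  ext p
  rw [mem_preimage, mem_iUnion_rotatedTriangle, mem_iUnion_rotatedTriangle]
  simp
  grind

theorem swapCoords_preimage_iUnion :
    swapCoords ⁻¹' (⋃ i, rotatedTriangle i) = ⋃ i, rotatedTriangle i := by
  ext p
  rw [mem_preimage, mem_iUnion_rotatedTriangle, mem_iUnion_rotatedTriangle]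
  simp
  grind

/-- The area of a planar region between two graphs over a compact interval. -/
theorem volume_between_graphs {a b : ℝ} (hab : a ≤ b) {f g : ℝ → ℝ} (hf : Continuous f)
    (hg : Continuous g) (hfg : ∀ x ∈ Icc a b, f x ≤ g x) :
    volume {p : EuclideanSpace ℝ (Fin 2) | p 0 ∈ Icc a b ∧ p 1 ∈ Icc (f (p 0)) (g (p 0))} =
      ENNReal.ofReal (∫ x in a..b, (g x - f x)) := by
  set R : Set (ℝ × ℝ) := {q | q.1 ∈ Icc a b ∧ q.2 ∈ Icc (f q.1) (g q.1)}
  have hR : MeasurableSet R := by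
    apply IsClosed.measurableSet
    exact (isClosed_Icc.preimage continuous_fst).inter
      ((isClosed_le (hf.comp continuous_fst) continuous_snd).inter
        (isClosed_le continuous_snd (hg.comp continuous_fst)))
  have hmp := (EuclideanSpace.volume_preserving_symm_measurableEquiv_toLp (Fin 2)).trans
    (volume_preserving_finTwoArrow ℝ)
  have h1 := hmp.measure_preimage hR.nullMeasurableSet
  have h2 : {p : EuclideanSpace ℝ (Fin 2) | p 0 ∈ Icc a b ∧ p 1 ∈ Icc (f (p 0)) (g (p 0))} =
    (MeasurableEquiv.finTwoArrow ∘ (MeasurableEquiv.toLp 2 (Fin 2 → ℝ)).symm) ⁻¹' R := rfl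
  rw [h2]
  refine h1.trans ?_
  rw [Measure.volume_eq_prod, Measure.prod_apply hR, intervalIntegral.integral_of_le hab,
    ← integral_Icc_eq_integral_Ioc, ofReal_integral_eq_lintegral_ofReal,
    ← lintegral_indicator measurableSet_Icc]
  · congr 1 with x
    by_cases hx : x ∈ Icc a b
    · have : Prod.mk x ⁻¹' R = Icc (f x) (g x) := by ext y; simp [R, hx.1, hx.2]
      rw [this, Real.volume_Icc, indicator_of_mem hx]
    · have : Prod.mk x ⁻¹' R = ∅ := by ext y; simp [R]; grind
      rw [this, indicator_of_notMem hx, measure_empty]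
  · exact ((hg.sub hf).continuousOn).integrableOn_Icc
  · filter_upwards [ae_restrict_mem measurableSet_Icc] with x hx
    exact sub_nonneg.2 (hfg x hx)

theorem integral_affine (a b k m : ℝ) :
    ∫ x in a..b, (k * x + m) = k * ((b ^ 2 - a ^ 2) / 2) + m * (b - a) := by
  rw [intervalIntegral.integral_add (Continuous.intervalIntegrable (by fun_prop) _ _)
    intervalIntegrable_const, intervalIntegral.integral_const_mul, integral_id,
    intervalIntegral.integral_const, smul_eq_mul, mul_comm m]

theorem sqrt_three_bounds : (1.732 : ℝ) < √3 ∧ √3 < 1.7321 :=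
  ⟨Real.lt_sqrt_of_sq_lt (by norm_num), (Real.sqrt_lt' (by norm_num)).2 (by norm_num)⟩

theorem volume_octant_le :
    volume ((⋃ i, rotatedTriangle i) ∩ {p | 0 ≤ p 0} ∩ {p | 0 ≤ p 1} ∩ {p | p 1 ≤ p 0}) ≤
      ENNReal.ofReal ((44 / 125) ^ 2 / 2 + (√3 / 2 - 88 / 125) ^ 2 * √3 / 6 +
        (37 / 250) ^ 2 * √3 / 2) := by
  have h3 : √3 * √3 = 3 := Real.mul_self_sqrt (by norm_num)
  obtain ⟨hlo, hhi⟩ := sqrt_three_bounds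
  have hsub : (⋃ i, rotatedTriangle i) ∩ {p | 0 ≤ p 0} ∩ {p | 0 ≤ p 1} ∩ {p | p 1 ≤ p 0} ⊆
      {p | p 0 ∈ Icc (0 : ℝ) (44 / 125) ∧ p 1 ∈ Icc 0 (p 0)} ∪
      {p | p 0 ∈ Icc (44 / 125) (√3 / 2 - 44 / 125) ∧
        p 1 ∈ Icc 0 ((√3 / 2 - 44 / 125 - p 0) * (√3 / 3))} ∪
      {p | p 0 ∈ Icc (44 / 125 : ℝ) (1 / 2) ∧
        p 1 ∈ Icc (√3 * p 0 - (√3 / 2 - 44 / 125)) (44 / 125)} := by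
    rintro p ⟨⟨⟨hU, h0⟩, h1⟩, h10⟩
    simp only [mem_ofPred_eq] at h0 h1 h10
    rw [mem_iUnion_rotatedTriangle] at hU
    by_cases hc : p 0 ≤ 44 / 125
    · exact .inl (.inl ⟨⟨h0, hc⟩, h1, h10⟩)
    push Not at hc
    rcases hU with ⟨ha, hb, -⟩ | ⟨-, hb, -⟩ | ⟨ha, -⟩ | ⟨-, hb, -⟩
    · exact .inr ⟨⟨hc.le, by nlinarith⟩, by linarith, ha⟩
    · nlinarith
    · linarith
    · refine .inl (.inr ⟨⟨hc.le, by nlinarith⟩, h1, ?_⟩)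
      nlinarith
  refine (measure_mono hsub).trans ((measure_union_le _ _).trans
    ((add_le_add (measure_union_le _ _) le_rfl).trans ?_))
  rw [volume_between_graphs (by norm_num) (g := fun x => x) continuous_const continuous_id
      (fun x hx => hx.1),
    volume_between_graphs (by linarith) continuous_const (by fun_prop)
      (fun x hx => mul_nonneg (by linarith [hx.2]) (by positivity)),
    volume_between_graphs (f := fun x => √3 * x - (√3 / 2 - 44 / 125)) (by norm_num) (by fun_prop) continuous_const
      (fun x hx => by nlinarith [hx.2])]
  have e1 : ∫ x in (0 : ℝ)..44 / 125, (x - 0) = (44 / 125) ^ 2 / 2 := by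
    simp
  have e2 : ∫ x in (44 / 125 : ℝ)..√3 / 2 - 44 / 125,
      ((√3 / 2 - 44 / 125 - x) * (√3 / 3) - 0) = (√3 / 2 - 88 / 125) ^ 2 * √3 / 6 := by
    rw [intervalIntegral.integral_congr (g := fun x => -(√3 / 3) * x +
      (√3 / 2 - 44 / 125) * (√3 / 3)) (fun x _ => by ring), integral_affine]
    ring
  have e3 : ∫ x in (44 / 125 : ℝ)..1 / 2, (44 / 125 - (√3 * x - (√3 / 2 - 44 / 125))) =
      (37 / 250) ^ 2 * √3 / 2 := by
    rw [intervalIntegral.integral_congr (g := fun x => -√3 * x + √3 / 2) (fun x _ => by ring),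
      integral_affine]
    ring
  rw [e1, e2, e3, ← ENNReal.ofReal_add (by positivity) (by positivity),
    ← ENNReal.ofReal_add (by positivity) (by positivity)]

theorem mem_frontier_of_add_smul_notMem {E : Type*} [AddCommGroup E] [Module ℝ E]
    [TopologicalSpace E] [ContinuousAdd E] [ContinuousSMul ℝ E] {s : Set E} {p v : E}
    (hp : p ∈ s) (hv : ∀ t : ℝ, 0 < t → p + t • v ∉ s) : p ∈ frontier s := by
  rw [frontier_eq_closure_inter_closure]
  refine ⟨subset_closure hp, ?_⟩
  have hcont : Continuous fun t : ℝ => p + t • v := by fun_prop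
  have hlim : Filter.Tendsto (fun t : ℝ => p + t • v) (nhdsWithin 0 (Ioi 0)) (nhds p) := by
    simpa using (hcont.tendsto 0).mono_left nhdsWithin_le_nhds
  exact mem_closure_of_tendsto hlim (eventually_mem_nhdsWithin.mono hv)

theorem exists_coords_of_mem_segment {a b a' b' : ℝ} {p : EuclideanSpace ℝ (Fin 2)}
    (hp : p ∈ segment ℝ !₂[a, b] !₂[a', b']) :
    ∃ t ∈ Icc (0 : ℝ) 1, p 0 = a + t * (a' - a) ∧ p 1 = b + t * (b' - b) := by
  rw [segment_eq_image'] at hp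
  obtain ⟨t, ht, rfl⟩ := hp
  exact ⟨t, ht, by simp, by simp⟩

theorem notMem_iUnion_rotatedTriangle {p : EuclideanSpace ℝ (Fin 2)} (h0 : 44 / 125 < p 0)
    (h1 : 0 ≤ p 1) (h : √3 / 2 - 44 / 125 < √3 * p 1 + p 0)
    (h' : 44 / 125 < p 1 ∨ √3 / 2 - 44 / 125 < √3 * p 0 - p 1) :
    p ∉ ⋃ i, rotatedTriangle i := by
  obtain ⟨hlo, hhi⟩ := sqrt_three_bounds
  rw [mem_iUnion_rotatedTriangle]
  rintro (⟨ha, hb, -⟩ | ⟨-, hb, -⟩ | ⟨ha, -⟩ | ⟨-, hb, -⟩)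
  · rcases h' with h' | h' <;> linarith
  · nlinarith
  · linarith
  · linarith

theorem ofReal_le_hausdorffMeasure_octant :
    ENNReal.ofReal 0.622 ≤ μH[1] (frontier (⋃ i, rotatedTriangle i) ∩ {p | 0 < p 0} ∩
      {p | 0 < p 1} ∩ {p | p 1 < p 0}) := by
  have h3 : √3 * √3 = 3 := Real.mul_self_sqrt (by norm_num)
  obtain ⟨hlo, hhi⟩ := sqrt_three_bounds
  set A := segment ℝ !₂[√3 / 2 - 44 / 125 - 0.093 * √3, 0.093]
    !₂[√3 / 2 - 44 / 125 - 0.001 * √3, 0.001] with hA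
  set B := segment ℝ !₂[0.353, √3 * 0.353 - (√3 / 2 - 44 / 125)]
    !₂[0.499, √3 * 0.499 - (√3 / 2 - 44 / 125)] with hB
  set C := segment ℝ !₂[(0.353 : ℝ), 44 / 125] !₂[0.499, 44 / 125] with hC
  have hA' : ∀ p ∈ A, 0.001 ≤ p 1 ∧ p 1 ≤ 0.093 ∧ p 0 = √3 / 2 - 44 / 125 - √3 * p 1 := by
    intro p hp
    obtain ⟨t, ⟨ht0, ht1⟩, hp0, hp1⟩ := exists_coords_of_mem_segment hp
    refine ⟨by linarith, by linarith, ?_⟩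
    rw [hp0, hp1]; ring
  have hB' : ∀ p ∈ B, 0.353 ≤ p 0 ∧ p 0 ≤ 0.499 ∧ p 1 = √3 * p 0 - (√3 / 2 - 44 / 125) := by
    intro p hp
    obtain ⟨t, ⟨ht0, ht1⟩, hp0, hp1⟩ := exists_coords_of_mem_segment hp
    refine ⟨by linarith, by linarith, ?_⟩
    rw [hp0, hp1]; ring
  have hC' : ∀ p ∈ C, 0.353 ≤ p 0 ∧ p 0 ≤ 0.499 ∧ p 1 = 44 / 125 := by
    intro p hp
    obtain ⟨t, ⟨ht0, ht1⟩, hp0, hp1⟩ := exists_coords_of_mem_segment hp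
    exact ⟨by linarith, by linarith, by linarith⟩
  have hmeas : ∀ x y : EuclideanSpace ℝ (Fin 2), MeasurableSet (segment ℝ x y) := fun x y => by
    rw [← convexHull_pair]
    exact ((Set.toFinite _).isCompact_convexHull ℝ).measurableSet
  have hsub : A ∪ B ∪ C ⊆ frontier (⋃ i, rotatedTriangle i) ∩ {p | 0 < p 0} ∩
      {p | 0 < p 1} ∩ {p | p 1 < p 0} := by
    rintro p ((hp | hp) | hp)
    · obtain ⟨hl, hu, he⟩ := hA' p hp
      have hx : 44 / 125 < p 0 := by nlinarith
      refine ⟨⟨⟨mem_frontier_of_add_smul_notMem (v := !₂[1, 0]) ?_ ?_, ?_⟩, ?_⟩, ?_⟩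
      · rw [mem_iUnion_rotatedTriangle]
        exact .inr (.inr (.inr ⟨by linarith, by linarith, by nlinarith⟩))
      · intro t ht
        apply notMem_iUnion_rotatedTriangle
        · simp; linarith
        · simp; linarith
        · simp; linarith
        · right; simp; nlinarith
      all_goals simp only [mem_ofPred_eq]; linarith
    · obtain ⟨hl, hu, he⟩ := hB' p hp
      have hy : 0.095 < p 1 := by nlinarith
      have hy' : p 1 < 44 / 125 := by nlinarith
      refine ⟨⟨⟨mem_frontier_of_add_smul_notMem (v := !₂[1, 0]) ?_ ?_, ?_⟩, ?_⟩, ?_⟩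
      · rw [mem_iUnion_rotatedTriangle]
        exact .inl ⟨by linarith, by linarith, by nlinarith⟩
      · intro t ht
        apply notMem_iUnion_rotatedTriangle
        · simp; linarith
        · simp; linarith
        · simp; nlinarith
        · right; simp; nlinarith
      all_goals simp only [mem_ofPred_eq]; linarith
    · obtain ⟨hl, hu, he⟩ := hC' p hp
      refine ⟨⟨⟨mem_frontier_of_add_smul_notMem (v := !₂[0, 1]) ?_ ?_, ?_⟩, ?_⟩, ?_⟩
      · rw [mem_iUnion_rotatedTriangle]
        exact .inl ⟨by linarith, by nlinarith, by nlinarith⟩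
      · intro t ht
        apply notMem_iUnion_rotatedTriangle
        · simp; linarith
        · simp; linarith
        · simp; nlinarith
        · left; simp; linarith
      all_goals simp only [mem_ofPred_eq]; linarith
  have hAB : Disjoint A B := by
    rw [Set.disjoint_left]
    intro p hp hq
    obtain ⟨-, hu, -⟩ := hA' p hp
    obtain ⟨hl, -, he⟩ := hB' p hq
    nlinarith
  have hABC : Disjoint (A ∪ B) C := by
    rw [Set.disjoint_left]
    rintro p (hp | hp) hq
    · obtain ⟨-, hu, -⟩ := hA' p hp
      obtain ⟨-, -, he⟩ := hC' p hq
      linarith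
    · obtain ⟨-, hl, he'⟩ := hB' p hp
      obtain ⟨-, -, he⟩ := hC' p hq
      nlinarith
  refine le_trans ?_ (measure_mono hsub)
  rw [measure_union hABC (hmeas _ _), measure_union hAB (hmeas _ _), hA, hB, hC,
    hausdorffMeasure_segment, hausdorffMeasure_segment, hausdorffMeasure_segment]
  have e1 : dist !₂[√3 / 2 - 44 / 125 - 0.093 * √3, 0.093]
    !₂[√3 / 2 - 44 / 125 - 0.001 * √3, 0.001] = 0.184 := by
    rw [EuclideanSpace.dist_eq, Real.sqrt_eq_iff_mul_self_eq (by positivity) (by norm_num)]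
    norm_num [Fin.sum_univ_two, Real.dist_eq, sq_abs]
    nlinarith
  have e2 : dist !₂[0.353, √3 * 0.353 - (√3 / 2 - 44 / 125)]
    !₂[0.499, √3 * 0.499 - (√3 / 2 - 44 / 125)] = 0.292 := by
    rw [EuclideanSpace.dist_eq, Real.sqrt_eq_iff_mul_self_eq (by positivity) (by norm_num)]
    norm_num [Fin.sum_univ_two, Real.dist_eq, sq_abs]
    nlinarith
  have e3 : dist !₂[(0.353 : ℝ), 44 / 125] !₂[0.499, 44 / 125] = 0.146 := by
    rw [EuclideanSpace.dist_eq, Real.sqrt_eq_iff_mul_self_eq (by positivity) (by norm_num)]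
    norm_num [Fin.sum_univ_two, Real.dist_eq, sq_abs]
  rw [edist_dist, edist_dist, edist_dist, e1, e2, e3, ← ENNReal.ofReal_add (by norm_num)
    (by norm_num), ← ENNReal.ofReal_add (by norm_num) (by norm_num)]
  exact ENNReal.ofReal_le_ofReal (by norm_num)

theorem volume_iUnion_rotatedTriangle_le :
    volume (⋃ i, rotatedTriangle i) ≤
      ENNReal.ofReal (8 * ((44 / 125) ^ 2 / 2 + (√3 / 2 - 88 / 125) ^ 2 * √3 / 6 +
        (37 / 250) ^ 2 * √3 / 2)) := by
  have h1 := measure_le_two_mul_inter (μ := volume) (σ := flipFst.toMeasurableEquiv)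
    flipFst.measurePreserving flipFst_preimage_iUnion (D := {p | 0 ≤ p 0})
    (fun p => by simpa using le_total 0 (p 0))
  have h2 := measure_le_two_mul_inter (μ := volume) (σ := flipSnd.toMeasurableEquiv)
    (A := (⋃ i, rotatedTriangle i) ∩ {p | 0 ≤ p 0})
    flipSnd.measurePreserving (congrArg₂ (· ∩ ·) flipSnd_preimage_iUnion rfl) (D := {p | 0 ≤ p 1})
    (fun p => by simpa using le_total 0 (p 1))
  have h3 := measure_le_two_mul_inter (μ := volume) (σ := swapCoords.toMeasurableEquiv)
    (A := (⋃ i, rotatedTriangle i) ∩ {p | 0 ≤ p 0} ∩ {p | 0 ≤ p 1})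
    swapCoords.measurePreserving
    ((congrArg₂ (fun s t => s ∩ {p | 0 ≤ p 1} ∩ t) swapCoords_preimage_iUnion rfl).trans
      (inter_right_comm _ _ _)) (D := {p | p 1 ≤ p 0})
    (fun p => by simpa using le_total (p 1) (p 0))
  calc volume (⋃ i, rotatedTriangle i) ≤ 2 * (2 * (2 * _)) :=
        h1.trans (mul_le_mul_right (h2.trans (mul_le_mul_right (h3.trans
          (mul_le_mul_right volume_octant_le _)) _)) _)
    _ = _ := by
        rw [ENNReal.ofReal_mul (by norm_num), ← mul_assoc, ← mul_assoc]
        norm_num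

theorem ofReal_le_hausdorffMeasure_frontier :
    ENNReal.ofReal (8 * 0.622) ≤ μH[1] (frontier (⋃ i, rotatedTriangle i)) := by
  have hfr : ∀ σ : EuclideanSpace ℝ (Fin 2) ≃ₗᵢ[ℝ] EuclideanSpace ℝ (Fin 2),
      σ ⁻¹' (⋃ i, rotatedTriangle i) = ⋃ i, rotatedTriangle i →
      σ ⁻¹' frontier (⋃ i, rotatedTriangle i) = frontier (⋃ i, rotatedTriangle i) := by
    intro σ hσ
    have := σ.toHomeomorph.preimage_frontier (⋃ i, rotatedTriangle i)
    exact this.trans (congrArg frontier hσ)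
  have m0 : Measurable fun p : EuclideanSpace ℝ (Fin 2) => p 0 := by fun_prop
  have m1 : Measurable fun p : EuclideanSpace ℝ (Fin 2) => p 1 := by fun_prop
  have h1 := two_mul_measure_inter_le (μ := μH[1]) (σ := flipFst.toMeasurableEquiv)
    (flipFst.toIsometryEquiv.measurePreserving_hausdorffMeasure 1)
    (hfr _ flipFst_preimage_iUnion) (D := {p | 0 < p 0}) (measurableSet_lt measurable_const m0)
    (Set.disjoint_left.2 fun p hp hq => by simp at hp hq; linarith)
  have h2 := two_mul_measure_inter_le (μ := μH[1]) (σ := flipSnd.toMeasurableEquiv)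
    (A := frontier (⋃ i, rotatedTriangle i) ∩ {p | 0 < p 0})
    (flipSnd.toIsometryEquiv.measurePreserving_hausdorffMeasure 1)
    (congrArg₂ (· ∩ ·) (hfr _ flipSnd_preimage_iUnion) rfl) (D := {p | 0 < p 1})
    (measurableSet_lt measurable_const m1)
    (Set.disjoint_left.2 fun p hp hq => by simp at hp hq; linarith)
  have h3 := two_mul_measure_inter_le (μ := μH[1]) (σ := swapCoords.toMeasurableEquiv)
    (A := frontier (⋃ i, rotatedTriangle i) ∩ {p | 0 < p 0} ∩ {p | 0 < p 1})
    (swapCoords.toIsometryEquiv.measurePreserving_hausdorffMeasure 1)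
    ((congrArg₂ (fun s t => s ∩ {p | 0 < p 1} ∩ t) (hfr _ swapCoords_preimage_iUnion) rfl).trans
      (inter_right_comm _ _ _)) (D := {p | p 1 < p 0}) (measurableSet_lt m1 m0)
    (Set.disjoint_left.2 fun p hp hq => by simp at hp hq; linarith)
  calc ENNReal.ofReal (8 * 0.622) = 2 * (2 * (2 * ENNReal.ofReal 0.622)) := by
        rw [ENNReal.ofReal_mul (by norm_num), ← mul_assoc, ← mul_assoc]
        norm_num
    _ ≤ _ := (mul_le_mul_right ((mul_le_mul_right ((mul_le_mul_right
        ofReal_le_hausdorffMeasure_octant _).trans h3) _).trans h2) _).trans h1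

theorem four_unit_triangles_ratio_gt :
    ∃ T : Fin 4 → Set (EuclideanSpace ℝ (Fin 2)),
      (∀ i, IsUnitEquilateralTriangle (T i)) ∧
      μH[1] (frontier (⋃ i, T i)) >
        ENNReal.ofReal (4 * Real.sqrt 3) * volume (⋃ i, T i) := by
  refine ⟨rotatedTriangle, ?_, ?_⟩
  · intro i
    have h := isUnitEquilateralTriangle_downTriangle
    fin_cases i
    exacts [h, h.preimage _, h.preimage _, (h.preimage _).preimage _]
  · have h3 : √3 * √3 = 3 := Real.mul_self_sqrt (by norm_num)
    obtain ⟨hlo, hhi⟩ := sqrt_three_bounds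
    refine lt_of_le_of_lt (mul_le_mul_right volume_iUnion_rotatedTriangle_le _)
      (lt_of_lt_of_le ?_ ofReal_le_hausdorffMeasure_frontier)
    rw [← ENNReal.ofReal_mul (by positivity), ENNReal.ofReal_lt_ofReal_iff (by norm_num)]
    nlinarith
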